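/- Let Δ ∈ ℕ. There exist θ ∈ (0,1) and C > 0, depending only on Δ, such that every finite connected simple graph G with all vertex degrees at most Δ satisfies t_mix^{P_G}(1−θ) ≤ C·t_mix^{P_lazy}(1/4), where t_mix^{P_G} is the mixing time of the simple random walk on G and t_mix^{P_lazy} is the mixing time of the lazy random walk on G. -/

import Mathlib

open Filter

noncomputable section

/-- Transition matrix of the simple random walk on a finite graph. -/
noncomputable def srwMatrix {V : Type*} [Fintype V] (G : SimpleGraph V) [DecidableRel G.Adj] :
    Matrix V V ℝ :=
  fun x y => if G.Adj x y then ((G.degree x : ℝ))⁻¹ else 0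

/-- Stationary distribution of the simple random walk: `deg x / (2|E|)`. -/
noncomputable def srwPi {V : Type*} [Fintype V] [DecidableEq V] (G : SimpleGraph V)
    [DecidableRel G.Adj] : V → ℝ :=
  fun x => (G.degree x : ℝ) / (2 * G.edgeFinset.card)

/-- The lazy version `(I + P)/2` of a transition matrix `P`. -/
noncomputable def lazyMatrix {V : Type*} [Fintype V] [DecidableEq V] (P : Matrix V V ℝ) :
    Matrix V V ℝ :=
  (2 : ℝ)⁻¹ • (1 + P)

/-- The chain with transition matrix `P` and stationary distribution `stat` is mixed within
total variation distance `θ` from every starting state at time `t`. -/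
def mixedAt {V : Type*} [Fintype V] [DecidableEq V] (P : Matrix V V ℝ) (stat : V → ℝ)
    (θ : ℝ) (t : ℕ) : Prop :=
  ∀ x, (2 : ℝ)⁻¹ * ∑ y, |(P ^ t) x y - stat y| ≤ θ

/-- Total variation mixing time (`sInf` over `ℕ`). -/
noncomputable def tmix {V : Type*} [Fintype V] [DecidableEq V] (P : Matrix V V ℝ)
    (stat : V → ℝ) (θ : ℝ) : ℕ :=
  sInf {t | mixedAt P stat θ t}

section
open Finset

theorem binomial_sum_sub_mean_sq (n : ℕ) (p : ℝ) :
    ∑ j ∈ range (n + 1), (n * p - j) ^ 2 * (n.choose j * p ^ j * (1 - p) ^ (n - j)) =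
      n * p * (1 - p) := by
  have h := congrArg (Polynomial.eval p) (bernsteinPolynomial.variance ℝ n)
  simpa [Polynomial.eval_finsetSum, bernsteinPolynomial] using h

theorem binomial_sum_eq_one (n : ℕ) (p : ℝ) :
    ∑ j ∈ range (n + 1), (n.choose j * p ^ j * (1 - p) ^ (n - j)) = 1 := by
  have h := add_pow p (1 - p) n
  rw [add_sub_cancel, one_pow] at h
  exact (sum_congr rfl fun j _ => by ring).trans h.symm

theorem binomial_sum_abs_sub_mean_le (n : ℕ) {p : ℝ} (hp0 : 0 ≤ p) (hp1 : p ≤ 1) :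
    ∑ j ∈ range (n + 1), |(j : ℝ) - n * p| * (n.choose j * p ^ j * (1 - p) ^ (n - j)) ≤
      √(n * p * (1 - p)) := by
  have hq : 0 ≤ 1 - p := by linarith
  have hw : ∀ j, 0 ≤ (n.choose j * p ^ j * (1 - p) ^ (n - j) : ℝ) := fun j => by positivity
  have hcs := Finset.sum_mul_sq_le_sq_mul_sq (range (n + 1))
    (fun j => |(j : ℝ) - n * p| * √(n.choose j * p ^ j * (1 - p) ^ (n - j)))
    (fun j => √(n.choose j * p ^ j * (1 - p) ^ (n - j)))
  simp only [mul_pow, sq_abs, Real.sq_sqrt (hw _), mul_assoc |_|, Real.mul_self_sqrt (hw _),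
    binomial_sum_eq_one, mul_one] at hcs
  refine Real.le_sqrt_of_sq_le (hcs.trans_eq ?_)
  rw [← binomial_sum_sub_mean_sq]
  exact sum_congr rfl fun j _ => by ring

section
variable {A : Type*} [NormedRing A] [NormedAlgebra ℝ A]

theorem smul_one_add_smul_pow_eq_sum (p : ℝ) (R : A) (n : ℕ) :
    ((1 - p) • (1 : A) + p • R) ^ n =
      ∑ j ∈ range (n + 1), (n.choose j * p ^ j * (1 - p) ^ (n - j)) • R ^ j := by
  have hc : Commute (p • R) ((1 - p) • (1 : A)) := ((Commute.one_right R).smul_left p).smul_right _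
  rw [add_comm, hc.add_pow]
  refine sum_congr rfl fun j _ => ?_
  rw [smul_pow, smul_pow, one_pow, smul_mul_smul_comm, mul_one, ← nsmul_eq_mul',
    ← Nat.cast_smul_eq_nsmul ℝ, smul_smul, mul_assoc]

theorem sum_index_mul_binomial_smul_pow (p : ℝ) (R : A) (m : ℕ) :
    ∑ j ∈ range (m + 1 + 1),
        ((j : ℝ) * ((m + 1).choose j * p ^ j * (1 - p) ^ (m + 1 - j))) • R ^ j =
      ((m + 1 : ℝ) * p) • (((1 - p) • (1 : A) + p • R) ^ m * R) := by
  rw [sum_range_succ', smul_one_add_smul_pow_eq_sum, sum_mul, smul_sum]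
  simp only [Nat.cast_zero, zero_mul, zero_smul, add_zero]
  refine sum_congr rfl fun j _ => ?_
  rw [smul_mul_assoc, ← pow_succ, smul_smul]
  congr 1
  have h : ((m : ℝ) + 1) * m.choose j = (m + 1).choose (j + 1) * (j + 1) := by
    exact_mod_cast Nat.add_one_mul_choose_eq m j
  rw [Nat.add_sub_add_right]
  push_cast
  linear_combination -(p ^ (j + 1) * (1 - p) ^ (m - j)) * h

theorem sum_sub_mean_mul_binomial_smul_pow (p : ℝ) (R : A) (m : ℕ) :
    ∑ j ∈ range (m + 1 + 1),
        (((j : ℝ) - (m + 1 : ℕ) * p) *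
          ((m + 1).choose j * p ^ j * (1 - p) ^ (m + 1 - j))) • R ^ j =
      ((m + 1 : ℕ) * p * (1 - p)) • (((1 - p) • (1 : A) + p • R) ^ m * (R - 1)) := by
  have hmean := smul_one_add_smul_pow_eq_sum p R (m + 1)
  have hindex := sum_index_mul_binomial_smul_pow p R m
  rw [sum_congr rfl fun j _ => by rw [sub_mul, sub_smul, mul_smul (((m + 1 : ℕ) : ℝ) * p)],
    sum_sub_distrib, ← smul_sum, ← hmean, hindex, pow_succ, mul_add]
  generalize ((1 - p) • (1 : A) + p • R) ^ m = B
  push_cast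
  simp only [mul_sub, mul_smul_comm, mul_one]
  module

/-- Powers of a lazy power-bounded element vary slowly: `‖Aᵐ (R - 1)‖` is of order `m ^ (-1/2)` for
`A = (1 - p) + p R`. -/
theorem norm_lazy_pow_mul_sub_one_le {p : ℝ} (hp0 : 0 < p) (hp1 : p < 1) {R : A}
    (hR : ∀ j, ‖R ^ j‖ ≤ 1) (m : ℕ) :
    √((m + 1 : ℕ) * p * (1 - p)) * ‖((1 - p) • (1 : A) + p • R) ^ m * (R - 1)‖ ≤ 1 := by
  have hq : 0 < 1 - p := by linarith
  have hs : 0 < ((m + 1 : ℕ) : ℝ) * p * (1 - p) := by positivity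
  have h := congrArg norm (sum_sub_mean_mul_binomial_smul_pow p R m)
  rw [norm_smul, Real.norm_of_nonneg hs.le] at h
  have hle : ((m + 1 : ℕ) * p * (1 - p)) * ‖((1 - p) • (1 : A) + p • R) ^ m * (R - 1)‖ ≤
      √((m + 1 : ℕ) * p * (1 - p)) := by
    rw [← h]
    refine (norm_sum_le _ _).trans
      ((sum_le_sum fun j _ => ?_).trans (binomial_sum_abs_sub_mean_le (m + 1) hp0.le hp1.le))
    have hw : 0 ≤ ((m + 1).choose j * p ^ j * (1 - p) ^ (m + 1 - j) : ℝ) := by positivity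
    rw [norm_smul, norm_mul, Real.norm_eq_abs, Real.norm_of_nonneg hw]
    exact mul_le_of_le_one_right (by positivity) (hR j)
  have hs' := Real.sqrt_pos.2 hs
  nth_rewrite 1 [← Real.mul_self_sqrt hs.le] at hle
  rw [mul_assoc] at hle
  exact le_of_mul_le_mul_left (by simpa using hle) hs'
end

section
variable {A : Type*} [NormedRing A] [NormedAlgebra ℝ A]

/-- With `L = (1 + P) / 2`, the identity `L² (L² - P) = (P² - 1)² / 16` shows that `L ^ (2 J + 2)` is
close to `L² P ^ J` after multiplication by an element `K` that almost annihilates `(P² - 1)²`. -/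
theorem norm_lazy_pow_sub_mul_le {P L K : A} (hL : L = (2 : ℝ)⁻¹ • (1 + P))
    (hP : ‖P‖ ≤ 1) (hL1 : ∀ j, ‖L ^ j‖ ≤ 1) (hPK : Commute P K) {c : ℝ}
    (hc : ‖(P ^ 2 - 1) ^ 2 * K‖ ≤ c) (J : ℕ) :
    ‖(L ^ (2 * J + 2) - L ^ 2 * P ^ J) * K‖ ≤ J * (c / 16) := by
  have hLsq : L ^ 2 * (L ^ 2 - P) = (16 : ℝ)⁻¹ • (P ^ 2 - 1) ^ 2 := by
    subst hL
    simp only [pow_two, smul_mul_assoc, mul_smul_comm, mul_add, add_mul, mul_sub, sub_mul, one_mul,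
      mul_one, mul_assoc]
    module
  induction J with
  | zero => simp
  | succ J ih =>
    have hsplit : (L ^ (2 * (J + 1) + 2) - L ^ 2 * P ^ (J + 1)) * K =
        (16 : ℝ)⁻¹ • (L ^ (2 * J) * ((P ^ 2 - 1) ^ 2 * K)) +
          (L ^ (2 * J + 2) - L ^ 2 * P ^ J) * K * P := by
      rw [← mul_smul_comm, ← smul_mul_assoc, ← hLsq, mul_assoc _ K P, ← hPK.eq]
      simp only [mul_add, pow_add, pow_one, mul_sub, sub_mul, mul_assoc, mul_one]
      abel
    rw [hsplit]
    have hfirst : ‖(16 : ℝ)⁻¹ • (L ^ (2 * J) * ((P ^ 2 - 1) ^ 2 * K))‖ ≤ c / 16 := by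
      rw [norm_smul, Real.norm_of_nonneg (by norm_num)]
      have := (norm_mul_le (L ^ (2 * J)) ((P ^ 2 - 1) ^ 2 * K)).trans
        (mul_le_of_le_one_left (norm_nonneg _) (hL1 _))
      linarith
    have hsecond := (norm_mul_le ((L ^ (2 * J + 2) - L ^ 2 * P ^ J) * K) P).trans
      (mul_le_of_le_one_right (norm_nonneg _) hP)
    refine (norm_add_le _ _).trans ?_
    push_cast
    linarith

theorem norm_sq_sub_one_sq_mul_pow_le {q : ℝ} (hq0 : 0 < q) (hq1 : q < 1) {P R : A}
    (hPR : P ^ 2 = q • (1 : A) + (1 - q) • R) (hR : ∀ j, ‖R ^ j‖ ≤ 1) (m : ℕ) :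
    ‖(P ^ 2 - 1) ^ 2 * P ^ (4 * m)‖ ≤ 1 / ((m + 1) * q) := by
  have hp : 0 < 1 - q := by linarith
  have hlazy := norm_lazy_pow_mul_sub_one_le hp (by linarith) hR m
  rw [sub_sub_cancel, ← hPR, ← pow_mul] at hlazy
  have hfactor : (P ^ 2 - 1) ^ 2 * P ^ (4 * m) =
      ((1 - q) • (P ^ (2 * m) * (R - 1))) * ((1 - q) • (P ^ (2 * m) * (R - 1))) := by
    have hsub : P ^ 2 - 1 = (1 - q) • (R - 1) := by
      rw [hPR]
      module
    rw [← mul_smul_comm, ← hsub]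
    have hcomm : Commute (P ^ 2 - 1) (P ^ (2 * m)) :=
      (Commute.pow_pow_self P 2 (2 * m)).sub_left (Commute.one_left _)
    rw [show 4 * m = 2 * m + 2 * m by ring, pow_add, pow_two (P ^ 2 - 1), mul_assoc,
      ← mul_assoc _ (P ^ (2 * m)), hcomm.eq, ← mul_assoc, ← mul_assoc, hcomm.eq]
    simp only [mul_assoc, hcomm.eq]
  rw [hfactor]
  refine (norm_mul_le _ _).trans ?_
  rw [norm_smul, Real.norm_of_nonneg hp.le]
  set x := ‖P ^ (2 * m) * (R - 1)‖
  have hs : 0 ≤ ((m + 1 : ℕ) : ℝ) * (1 - q) * q := by positivity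
  have hsq : (((m + 1 : ℕ) : ℝ) * (1 - q) * q) * (x * x) ≤ 1 := by
    rw [← Real.mul_self_sqrt hs, mul_mul_mul_comm]
    exact mul_le_one₀ hlazy (by positivity) hlazy
  rw [le_div_iff₀ (by positivity)]
  push_cast at hsq
  nlinarith [mul_le_mul_of_nonneg_left hsq hp.le]
end

section
open scoped Matrix.Norms.Operator
open Matrix
variable {V : Type*} [Fintype V]

theorem linfty_norm_le_iff {M : Matrix V V ℝ} {c : ℝ} (hc : 0 ≤ c) :
    ‖M‖ ≤ c ↔ ∀ x, ∑ y, |M x y| ≤ c := by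
  lift c to NNReal using hc
  rw [Matrix.linfty_opNorm_def, NNReal.coe_le_coe, Finset.sup_le_iff]
  simp [← NNReal.coe_le_coe]

theorem of_const_mul {stat : V → ℝ} {P : Matrix V V ℝ} (hinv : stat ᵥ* P = stat) :
    (Matrix.of fun _ : V => stat) * P = Matrix.of fun _ => stat := by
  ext x y
  exact congrFun hinv y

variable [DecidableEq V]

theorem linfty_norm_le_one_of_mem_rowStochastic {M : Matrix V V ℝ}
    (hM : M ∈ rowStochastic ℝ V) : ‖M‖ ≤ 1 := by
  refine (linfty_norm_le_iff zero_le_one).2 fun x => ?_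
  simp only [abs_of_nonneg (hM.1 x _)]
  exact (sum_row_of_mem_rowStochastic hM x).le

/-- Mixing expressed in the operator norm on row vectors with the `ℓ¹` norm. -/
theorem mixedAt_iff_norm_le {P : Matrix V V ℝ} {stat : V → ℝ} {θ : ℝ} (hθ : 0 ≤ θ) {t : ℕ} :
    mixedAt P stat θ t ↔ ‖P ^ t - Matrix.of fun _ => stat‖ ≤ 2 * θ := by
  rw [linfty_norm_le_iff (by positivity), mixedAt]
  refine forall_congr' fun x => ?_
  simp only [Matrix.sub_apply, Matrix.of_apply]
  constructor <;> intro h <;> linarith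

theorem lazyMatrix_mem_rowStochastic {P : Matrix V V ℝ} (hP : P ∈ rowStochastic ℝ V) :
    lazyMatrix P ∈ rowStochastic ℝ V := by
  have h := convex_rowStochastic (one_mem (rowStochastic ℝ V)) hP
    (by norm_num : (0 : ℝ) ≤ 2⁻¹) (by norm_num : (0 : ℝ) ≤ 2⁻¹) (by norm_num)
  rwa [← smul_add] at h

theorem exists_eq_smul_one_add_smul_rowStochastic {A : Matrix V V ℝ}
    (hA : A ∈ rowStochastic ℝ V) {q : ℝ} (hq1 : q < 1) (hq : ∀ x, q ≤ A x x) :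
    ∃ R ∈ rowStochastic ℝ V, A = q • (1 : Matrix V V ℝ) + (1 - q) • R := by
  have hp : 0 < 1 - q := by linarith
  refine ⟨(1 - q)⁻¹ • (A - q • 1), mem_rowStochastic_iff_sum.2 ⟨fun x y => ?_, fun x => ?_⟩, ?_⟩
  · refine mul_nonneg (inv_nonneg.2 hp.le) ?_
    by_cases hxy : x = y
    · subst hxy
      simpa using hq x
    · simpa [Matrix.one_apply, hxy] using hA.1 x y
  · simp [← Finset.mul_sum, Matrix.one_apply, Finset.sum_sub_distrib,
      sum_row_of_mem_rowStochastic hA, hp.ne']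
  · rw [smul_inv_smul₀ hp.ne']
    abel

theorem sum_abs_mul_apply_sub_le {P : Matrix V V ℝ} (hP : P ∈ rowStochastic ℝ V) {stat : V → ℝ}
    (hinv : stat ᵥ* P = stat) (M : Matrix V V ℝ) (x : V) :
    ∑ y, |(M * P) x y - stat y| ≤ ∑ y, |M x y - stat y| := by
  calc ∑ y, |(M * P) x y - stat y|
      = ∑ y, |∑ z, (M x z - stat z) * P z y| := by
        refine sum_congr rfl fun y _ => ?_
        nth_rewrite 1 [← hinv]
        simp only [Matrix.mul_apply, Matrix.vecMul, dotProduct, sub_mul, sum_sub_distrib]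
    _ ≤ ∑ y, ∑ z, |M x z - stat z| * P z y := by
        refine sum_le_sum fun y _ => (abs_sum_le_sum_abs _ _).trans_eq ?_
        exact sum_congr rfl fun z _ => by rw [abs_mul, abs_of_nonneg (hP.1 z y)]
    _ = ∑ z, |M x z - stat z| := by
        rw [sum_comm]
        simp only [← mul_sum, sum_row_of_mem_rowStochastic hP, mul_one]

theorem add_sub_abs_sub_le {a b c s : ℝ} (ha : 0 ≤ a) (hb : 0 ≤ b) (hc : 0 ≤ c) (hs : 0 ≤ s) :
    4⁻¹ * (a + 2 * b + c) + s - |4⁻¹ * (a + 2 * b + c) - s| ≤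
      (a + s - |a - s|) + (b + s - |b - s|) + (c + s - |c - s|) := by
  rcases abs_cases (4⁻¹ * (a + 2 * b + c) - s) with h | h <;>
  rcases abs_cases (a - s) with h1 | h1 <;> rcases abs_cases (b - s) with h2 | h2 <;>
  rcases abs_cases (c - s) with h3 | h3 <;> linarith

/-- For a probability vector `μ`, `2 - ‖μ - stat‖₁` is twice the mass of the minimum of `μ` and `stat`.
This overlap is monotone in time, so the one of the mixture `L² P ^ N` is at most three times the
one of `P ^ (N + 2)`. -/
theorem two_sub_sum_abs_lazy_sq_mul_pow_le {P : Matrix V V ℝ} (hP : P ∈ rowStochastic ℝ V)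
    {stat : V → ℝ} (hstat0 : ∀ x, 0 ≤ stat x) (hstat1 : ∑ x, stat x = 1)
    (hinv : stat ᵥ* P = stat) (N : ℕ) (x : V) :
    2 - ∑ y, |(lazyMatrix P ^ 2 * P ^ N) x y - stat y| ≤
      3 * (2 - ∑ y, |(P ^ (N + 2)) x y - stat y|) := by
  have hrow : ∀ y, (lazyMatrix P ^ 2 * P ^ N) x y =
      4⁻¹ * ((P ^ N) x y + 2 * (P ^ (N + 1)) x y + (P ^ (N + 2)) x y) := by
    intro y
    have h : lazyMatrix P ^ 2 * P ^ N =
        (4 : ℝ)⁻¹ • (P ^ N + (2 : ℝ) • P ^ (N + 1) + P ^ (N + 2)) := by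
      rw [add_comm N, add_comm N, pow_add, pow_add, lazyMatrix]
      simp only [pow_two, pow_one, smul_mul_assoc, mul_smul_comm, mul_add, add_mul, one_mul,
        mul_one, mul_assoc]
      module
    simp [h]
  have hN : ∀ k, P ^ k ∈ rowStochastic ℝ V := fun k => pow_mem hP k
  have hpoint := sum_le_sum fun y (_ : y ∈ univ) =>
    add_sub_abs_sub_le ((hN N).1 x y) ((hN (N + 1)).1 x y) ((hN (N + 2)).1 x y) (hstat0 y)
  simp only [sum_add_distrib, sum_sub_distrib, ← mul_sum, hstat1,
    sum_row_of_mem_rowStochastic (hN _)] at hpoint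
  have h1 := sum_abs_mul_apply_sub_le hP hinv (P ^ N) x
  have h2 := sum_abs_mul_apply_sub_le hP hinv (P ^ (N + 1)) x
  rw [← pow_succ] at h1 h2
  simp only [hrow]
  linarith

theorem of_const_mul_pow {stat : V → ℝ} {P : Matrix V V ℝ} (hinv : stat ᵥ* P = stat) (k : ℕ) :
    (Matrix.of fun _ : V => stat) * P ^ k = Matrix.of fun _ => stat := by
  induction k with
  | zero => simp
  | succ k ih => rw [pow_succ, ← mul_assoc, ih, of_const_mul hinv]

theorem vecMul_lazyMatrix {stat : V → ℝ} {P : Matrix V V ℝ} (hinv : stat ᵥ* P = stat) :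
    stat ᵥ* lazyMatrix P = stat := by
  rw [lazyMatrix, vecMul_smul, vecMul_add, vecMul_one, hinv]
  module

theorem mixedAt_of_mixedAt_lazyMatrix {P : Matrix V V ℝ} (hP : P ∈ rowStochastic ℝ V)
    {stat : V → ℝ} (hstat0 : ∀ x, 0 ≤ stat x) (hstat1 : ∑ x, stat x = 1)
    (hinv : stat ᵥ* P = stat) {D : ℕ} (hD0 : 0 < D)
    (hD : ∀ x, (D + 1 : ℝ)⁻¹ ≤ (P ^ 2) x x) {t : ℕ}
    (ht : mixedAt (lazyMatrix P) stat (1 / 4) t) :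
    mixedAt P stat (1 - 1 / 5) (t + 4 * (t * (D + 1)) + 2) := by
  set L := lazyMatrix P with hLdef
  set S : Matrix V V ℝ := Matrix.of fun _ => stat with hSdef
  have hL : L ∈ rowStochastic ℝ V := lazyMatrix_mem_rowStochastic hP
  set K := P ^ (4 * (t * (D + 1))) with hK
  have hq1 : (D + 1 : ℝ)⁻¹ < 1 :=
    inv_lt_one_of_one_lt₀ (by exact_mod_cast Nat.lt_add_of_pos_left hD0)
  obtain ⟨R, hR, hPR⟩ := exists_eq_smul_one_add_smul_rowStochastic (pow_mem hP 2) hq1 hD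
  have hdiff : ‖(P ^ 2 - 1) ^ 2 * K‖ ≤ _ :=
    norm_sq_sub_one_sq_mul_pow_le (by positivity) hq1 hPR
      (fun j => linfty_norm_le_one_of_mem_rowStochastic (pow_mem hR j)) (t * (D + 1))
  have hcmp := norm_lazy_pow_sub_mul_le (L := L) rfl (linfty_norm_le_one_of_mem_rowStochastic hP)
    (fun j => linfty_norm_le_one_of_mem_rowStochastic (pow_mem hL j))
    (Commute.self_pow P _) hdiff t
  have hsmall : (t : ℝ) * (1 / (((t * (D + 1) : ℕ) + 1) * (D + 1 : ℝ)⁻¹) / 16) ≤ 1 / 16 := by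
    push_cast
    rw [mul_div_assoc', mul_one_div]
    gcongr
    rw [div_le_one (by positivity), ← div_eq_mul_inv, le_div_iff₀ (by positivity)]
    linarith
  have hmix : ‖L ^ (2 * t + 2) * K - S‖ ≤ 1 / 2 := by
    have hfactor : L ^ (2 * t + 2) * K - S = (L ^ t - S) * (L ^ (t + 2) * K) := by
      rw [sub_mul, ← mul_assoc S, hSdef, of_const_mul_pow (vecMul_lazyMatrix hinv),
        of_const_mul_pow hinv, ← mul_assoc, ← pow_add]
      congr 3
      ring
    rw [hfactor]
    refine (norm_mul_le _ _).trans ((mul_le_of_le_one_right (norm_nonneg _) ?_).trans ?_)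
    · exact linfty_norm_le_one_of_mem_rowStochastic (mul_mem (pow_mem hL _) (pow_mem hP _))
    · exact ((mixedAt_iff_norm_le (by norm_num)).1 ht).trans (by norm_num)
  have hfinal : ‖L ^ 2 * P ^ (t + 4 * (t * (D + 1))) - S‖ ≤ 9 / 16 := by
    have hsplit : L ^ 2 * P ^ (t + 4 * (t * (D + 1))) - S =
        (L ^ (2 * t + 2) * K - S) - (L ^ (2 * t + 2) - L ^ 2 * P ^ t) * K := by
      rw [sub_mul, pow_add P, ← mul_assoc]
      abel
    rw [hsplit]
    refine (norm_sub_le _ _).trans ?_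
    linarith
  intro x
  have hx := (linfty_norm_le_iff (by norm_num)).1 hfinal x
  have hov := two_sub_sum_abs_lazy_sq_mul_pow_le hP hstat0 hstat1 hinv (t + 4 * (t * (D + 1))) x
  simp only [Matrix.sub_apply, hSdef, Matrix.of_apply] at hx
  linarith

/-- A stochastic matrix with a strictly positive power mixes. -/
theorem exists_mixedAt_of_pow_pos {P : Matrix V V ℝ} (hP : P ∈ rowStochastic ℝ V)
    {stat : V → ℝ} (hstat0 : ∀ x, 0 ≤ stat x) (hstat1 : ∑ x, stat x = 1)
    (hinv : stat ᵥ* P = stat) {n : ℕ} (hpos : ∀ x y, 0 < (P ^ n) x y) {θ : ℝ} (hθ : 0 < θ) :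
    ∃ t, mixedAt P stat θ t := by
  cases isEmpty_or_nonempty V
  · exact ⟨0, fun x => isEmptyElim x⟩
  obtain ⟨⟨x₀, y₀⟩, hmin⟩ := Finite.exists_min fun z : V × V => (P ^ n) z.1 z.2
  set S : Matrix V V ℝ := Matrix.of fun _ => stat with hSdef
  have hPn : P ^ n ∈ rowStochastic ℝ V := pow_mem hP n
  have hS : S ∈ rowStochastic ℝ V :=
    mem_rowStochastic_iff_sum.2 ⟨fun _ y => hstat0 y, fun _ => hstat1⟩
  set ε := (P ^ n) x₀ y₀ / 2 with hε
  have hε0 : 0 < ε := half_pos (hpos x₀ y₀)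
  have hε1 : ε < 1 := by
    have := le_one_of_mem_rowStochastic hPn (i := x₀) (j := y₀)
    linarith
  have hp : 0 < 1 - ε := by linarith
  have hSP : S * P ^ n = S := of_const_mul_pow hinv n
  have hMS : ∀ M ∈ rowStochastic ℝ V, M * S = S := by
    intro M hM
    ext x y
    simp [Matrix.mul_apply, hSdef, ← sum_mul, sum_row_of_mem_rowStochastic hM]
  obtain ⟨T, hT, hPT⟩ : ∃ T ∈ rowStochastic ℝ V, P ^ n = ε • S + (1 - ε) • T := by
    refine ⟨(1 - ε)⁻¹ • (P ^ n - ε • S),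
      mem_rowStochastic_iff_sum.2 ⟨fun x y => ?_, fun x => ?_⟩, ?_⟩
    · refine mul_nonneg (inv_nonneg.2 hp.le) (sub_nonneg.2 ?_)
      calc ε * S x y ≤ ε := mul_le_of_le_one_right hε0.le (le_one_of_mem_rowStochastic hS)
        _ ≤ (P ^ n) x₀ y₀ := half_le_self (hpos x₀ y₀).le
        _ ≤ (P ^ n) x y := hmin (x, y)
    · simp [← mul_sum, sum_sub_distrib, sum_row_of_mem_rowStochastic hPn,
        sum_row_of_mem_rowStochastic hS, hp.ne']
    · rw [smul_inv_smul₀ hp.ne']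
      abel
  have hST : S * T = S := by
    have h : (1 - ε) • (S * T) = (1 - ε) • S := by
      rw [hPT, mul_add, mul_smul_comm, mul_smul_comm, hMS S hS] at hSP
      rw [sub_smul 1 ε S, one_smul, eq_sub_iff_add_eq', hSP]
    exact smul_right_injective _ hp.ne' h
  have hpow : ∀ k, P ^ (n * k) - S = (1 - ε) ^ k • (T ^ k - S) := by
    intro k
    induction k with
    | zero => simp
    | succ k ih =>
      have hstep : P ^ (n * (k + 1)) - S = (P ^ (n * k) - S) * P ^ n := by
        rw [sub_mul, hSP, mul_add, mul_one, pow_add]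
      rw [hstep, ih, hPT, smul_mul_assoc, mul_add, mul_smul_comm, mul_smul_comm, sub_mul, sub_mul,
        hMS S hS, hMS _ (pow_mem hT k), hST, sub_self, smul_zero, zero_add, smul_smul, ← pow_succ,
        ← pow_succ]
  obtain ⟨k, hk⟩ := exists_pow_lt_of_lt_one hθ (by linarith : 1 - ε < 1)
  refine ⟨n * k, (mixedAt_iff_norm_le hθ.le).2 ?_⟩
  rw [← hSdef, hpow, norm_smul, Real.norm_of_nonneg (by positivity)]
  have hnorm : ‖T ^ k - S‖ ≤ 2 := by
    have h1 := linfty_norm_le_one_of_mem_rowStochastic (pow_mem hT k)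
    have h2 := linfty_norm_le_one_of_mem_rowStochastic hS
    exact (norm_sub_le _ _).trans (by linarith)
  rw [mul_comm 2]
  gcongr
end

section
open Matrix
variable {V : Type*} [Fintype V] {G : SimpleGraph V} [DecidableRel G.Adj]

theorem srwMatrix_nonneg (x y : V) : 0 ≤ srwMatrix G x y := by
  unfold srwMatrix
  split_ifs <;> positivity

variable [DecidableEq V]

theorem srwMatrix_mem_rowStochastic (hdeg : ∀ x, 0 < G.degree x) :
    srwMatrix G ∈ rowStochastic ℝ V := by
  refine mem_rowStochastic_iff_sum.2 ⟨srwMatrix_nonneg, fun x => ?_⟩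
  have hx : (G.degree x : ℝ) ≠ 0 := by exact_mod_cast (hdeg x).ne'
  simp [srwMatrix, ← sum_filter, ← SimpleGraph.neighborFinset_eq_filter, hx]

theorem srwPi_nonneg (x : V) : 0 ≤ srwPi G x := by
  unfold srwPi
  positivity

theorem sum_srwPi [Nonempty V] (hdeg : ∀ x, 0 < G.degree x) : ∑ x, srwPi G x = 1 := by
  have hsum : (∑ x, (G.degree x : ℝ)) = 2 * G.edgeFinset.card := by
    exact_mod_cast G.sum_degrees_eq_twice_card_edges
  have hpos : 0 < ∑ x, (G.degree x : ℝ) :=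
    sum_pos (fun x _ => by exact_mod_cast hdeg x) univ_nonempty
  simp only [srwPi]
  rw [← sum_div, ← hsum, div_self hpos.ne']

theorem srwPi_vecMul_srwMatrix (hdeg : ∀ x, 0 < G.degree x) :
    srwPi G ᵥ* srwMatrix G = srwPi G := by
  ext y
  have hterm : ∀ x, srwPi G x * srwMatrix G x y =
      if G.Adj y x then (2 * (G.edgeFinset.card : ℝ))⁻¹ else 0 := by
    intro x
    have hx : (G.degree x : ℝ) ≠ 0 := by exact_mod_cast (hdeg x).ne'
    simp only [srwPi, srwMatrix, G.adj_comm x y]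
    split_ifs
    · field_simp
    · simp
  simp only [vecMul, dotProduct, hterm]
  simp [srwPi, ← sum_filter, ← SimpleGraph.neighborFinset_eq_filter, div_eq_mul_inv]

theorem inv_le_srwMatrix_sq_apply_self (hdeg : ∀ x, 0 < G.degree x) {D : ℕ}
    (hD : ∀ x, G.degree x ≤ D) (x : V) : (D + 1 : ℝ)⁻¹ ≤ (srwMatrix G ^ 2) x x := by
  have hstep : ∀ y, srwMatrix G x y * (D + 1 : ℝ)⁻¹ ≤ srwMatrix G x y * srwMatrix G y x := by
    intro y
    by_cases hxy : G.Adj x y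
    · refine mul_le_mul_of_nonneg_left ?_ (srwMatrix_nonneg x y)
      have hy : (0 : ℝ) < G.degree y := by exact_mod_cast hdeg y
      have hyD : (G.degree y : ℝ) ≤ D := by exact_mod_cast hD y
      rw [srwMatrix, if_pos hxy.symm]
      exact inv_anti₀ hy (by linarith)
    · simp [srwMatrix, hxy]
  calc (D + 1 : ℝ)⁻¹ = ∑ y, srwMatrix G x y * (D + 1 : ℝ)⁻¹ := by
        rw [← sum_mul, sum_row_of_mem_rowStochastic (srwMatrix_mem_rowStochastic hdeg), one_mul]
    _ ≤ ∑ y, srwMatrix G x y * srwMatrix G y x := sum_le_sum fun y _ => hstep y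
    _ = (srwMatrix G ^ 2) x x := by rw [pow_two, Matrix.mul_apply]

theorem exists_lazyMatrix_srwMatrix_pow_pos (hG : G.Connected) (hdeg : ∀ x, 0 < G.degree x) :
    ∃ n, ∀ x y, 0 < (lazyMatrix (srwMatrix G) ^ n) x y := by
  set L := lazyMatrix (srwMatrix G) with hLdef
  have hL : L ∈ rowStochastic ℝ V :=
    lazyMatrix_mem_rowStochastic (srwMatrix_mem_rowStochastic hdeg)
  have hmul : ∀ n x y z, 0 < (L ^ n) x y → 0 < L y z → 0 < (L ^ (n + 1)) x z := by
    intro n x y z hxy hyz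
    rw [pow_succ, Matrix.mul_apply]
    exact sum_pos' (fun w _ => mul_nonneg ((pow_mem hL n).1 x w) (hL.1 w z))
      ⟨y, mem_univ y, mul_pos hxy hyz⟩
  have hdiag : ∀ x, 0 < L x x := by
    intro x
    simp [hLdef, lazyMatrix, srwMatrix]
  have hadj : ∀ x y, G.Adj x y → 0 < L x y := by
    intro x y hxy
    simp [hLdef, lazyMatrix, srwMatrix, hxy, hxy.ne, hdeg x]
  have hall : ∀ x y, ∀ᶠ n in atTop, 0 < (L ^ n) x y := by
    intro x y
    have hreach := (SimpleGraph.reachable_iff_reflTransGen x y).1 (hG.preconnected x y)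
    induction hreach with
    | refl =>
      refine Eventually.of_forall fun n => ?_
      induction n with
      | zero => simp
      | succ n ih => exact hmul n x x x ih (hdiag x)
    | tail _ hyz ih =>
      refine (tendsto_atTop_atTop.2 fun b => ⟨b + 1, fun a ha => ?_⟩ : Tendsto (fun n : ℕ => n - 1)
        atTop atTop).eventually ih |>.and (eventually_ge_atTop 1) |>.mono fun n hn => ?_
      · omega
      · have := hmul _ _ _ _ hn.1 (hadj _ _ hyz)
        rwa [Nat.sub_add_cancel hn.2] at this
  exact (eventually_all.2 fun x => eventually_all.2 (hall x)).exists

theorem not_mixedAt_zero [Nontrivial V] (P : Matrix V V ℝ) (stat : V → ℝ) :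
    ¬ mixedAt P stat (1 / 4) 0 := by
  intro h
  obtain ⟨x, y, hxy⟩ := exists_pair_ne V
  have hpair : ∀ a b : V, a ≠ b → |1 - stat a| + |stat b| ≤ 1 / 2 := by
    intro a b hab
    have hle := sum_le_sum_of_subset_of_nonneg (subset_univ {a, b})
      fun z _ _ => abs_nonneg ((P ^ 0) a z - stat z)
    rw [sum_pair hab] at hle
    simp only [pow_zero, Matrix.one_apply_eq, Matrix.one_apply_ne hab, zero_sub, abs_neg] at hle
    have := h a
    simp only [pow_zero] at this
    linarith
  have h1 := hpair x y hxy
  have h2 := hpair y x hxy.symm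
  linarith [le_abs_self (1 - stat x), le_abs_self (1 - stat y), le_abs_self (stat x),
    le_abs_self (stat y)]

theorem mixedAt_zero_of_subsingleton [Subsingleton V] (P : Matrix V V ℝ) :
    mixedAt P (srwPi G) (1 - 1 / 5) 0 := by
  intro x
  have : Unique V := uniqueOfSubsingleton x
  rw [Fintype.sum_subsingleton _ x]
  simp [srwPi]
  norm_num
end

end

/-- There exist `θ ∈ (0,1)` and `C > 0`, depending only on `Δ`, such that for
every finite connected graph of maximal degree at most `Δ`, the mixing time of the SRW at
level `1-θ` is finite and at most `C` times the mixing time of the lazy walk at level `1/4`. -/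
theorem stmt9 (Δ : ℕ) :
    ∃ θ ∈ Set.Ioo (0 : ℝ) 1, ∃ C : ℝ, 0 < C ∧
      ∀ (V : Type) [Fintype V] [DecidableEq V] (G : SimpleGraph V) [DecidableRel G.Adj],
        G.Connected → (∀ x, G.degree x ≤ Δ) →
        {t : ℕ | mixedAt (srwMatrix G) (srwPi G) (1 - θ) t}.Nonempty ∧
        (tmix (srwMatrix G) (srwPi G) (1 - θ) : ℝ) ≤
          C * (tmix (lazyMatrix (srwMatrix G)) (srwPi G) (1/4) : ℝ) := by
  refine ⟨1 / 5, by norm_num, 4 * Δ + 7, by positivity, fun V _ _ G _ hG hΔ => ?_⟩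
  rcases subsingleton_or_nontrivial V with hV | hV
  · have h0 : mixedAt (srwMatrix G) (srwPi G) (1 - 1 / 5) 0 := mixedAt_zero_of_subsingleton _
    refine ⟨⟨0, h0⟩, ?_⟩
    rw [show tmix (srwMatrix G) (srwPi G) (1 - 1 / 5) = 0 from Nat.le_zero.1 (Nat.sInf_le h0),
      Nat.cast_zero]
    positivity
  have hdeg : ∀ x, 0 < G.degree x := fun x => hG.preconnected.degree_pos_of_nontrivial x
  have hP := srwMatrix_mem_rowStochastic hdeg
  have hinv := srwPi_vecMul_srwMatrix hdeg
  have hsum := sum_srwPi hdeg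
  obtain ⟨x⟩ := hG.nonempty
  obtain ⟨n, hn⟩ := exists_lazyMatrix_srwMatrix_pow_pos hG hdeg
  have hmem : mixedAt (lazyMatrix (srwMatrix G)) (srwPi G) (1 / 4)
      (tmix (lazyMatrix (srwMatrix G)) (srwPi G) (1 / 4)) :=
    Nat.sInf_mem (exists_mixedAt_of_pow_pos (lazyMatrix_mem_rowStochastic hP) srwPi_nonneg hsum
      (vecMul_lazyMatrix hinv) hn (by norm_num))
  generalize tmix (lazyMatrix (srwMatrix G)) (srwPi G) (1 / 4) = t at hmem ⊢
  have ht : 1 ≤ t := Nat.one_le_iff_ne_zero.2 fun h => not_mixedAt_zero _ _ (h ▸ hmem)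
  have hmix := mixedAt_of_mixedAt_lazyMatrix hP srwPi_nonneg hsum hinv ((hdeg x).trans_le (hΔ x))
    (inv_le_srwMatrix_sq_apply_self hdeg hΔ) hmem
  refine ⟨⟨_, hmix⟩, ?_⟩
  have hle : (tmix (srwMatrix G) (srwPi G) (1 - 1 / 5) : ℝ) ≤
      (t + 4 * (t * (Δ + 1)) + 2 : ℕ) := by
    exact_mod_cast Nat.sInf_le hmix
  refine hle.trans ?_
  have ht' : (1 : ℝ) ≤ t := by exact_mod_cast ht
  push_cast
  linarith
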